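/- Let n ≥ 2, 1 < q < ∞, and suppose (θ1,θ2) ∈ (A ∪ B) ∩ (C_q ∪ D_q). Then w(x) = |x'|^{θ1}|x|^{θ2} is an A_q-weight: there exists a constant C = C(n,q,θ1,θ2) > 0 such that for every ball B ⊂ ℝ^n, (|B|^{-1} ∫_B w dx) · (|B|^{-1} ∫_B w^{−1/(q−1)} dx)^{q−1} ≤ C, where |B| is the Lebesgue measure of B. -/

import Mathlib

open MeasureTheory Metric Set
open scoped ENNReal NNReal Topology

noncomputable section

/-- `ℝ^n` as a Euclidean space. -/
abbrev En (n : ℕ) := EuclideanSpace ℝ (Fin n)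

/-- `|x'|`: the Euclidean norm of the first `n-1` coordinates of `x`. -/
def normPrime (n : ℕ) (x : En n) : ℝ :=
  Real.sqrt (∑ i : Fin n, if (i : ℕ) + 1 < n then (x i) ^ 2 else 0)

/-- The anisotropic weight `w(x) = |x'|^θ1 * |x|^θ2`. -/
def weight (n : ℕ) (θ1 θ2 : ℝ) (x : En n) : ℝ :=
  normPrime n x ^ θ1 * ‖x‖ ^ θ2

/-- The measure `dμ = w dx` on `ℝ^n`. -/
def muW (n : ℕ) (θ1 θ2 : ℝ) : Measure (En n) :=
  (volume : Measure (En n)).withDensity fun x => ENNReal.ofReal (weight n θ1 θ2 x)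

/-- The index set `𝒜 = {(a,b) : a > -(n-1), b ≥ 0}`. -/
def setA (n : ℕ) : Set (ℝ × ℝ) := {p | -((n : ℝ) - 1) < p.1 ∧ 0 ≤ p.2}

/-- The index set `ℬ = {(a,b) : a > -(n-1), b < 0, a + b > -n}`. -/
def setB (n : ℕ) : Set (ℝ × ℝ) :=
  {p | -((n : ℝ) - 1) < p.1 ∧ p.2 < 0 ∧ -(n : ℝ) < p.1 + p.2}

/-- The index set `𝒞_q = {(a,b) : a < (n-1)(q-1), b ≤ 0}`. -/
def setC (n : ℕ) (q : ℝ) : Set (ℝ × ℝ) := {p | p.1 < ((n : ℝ) - 1) * (q - 1) ∧ p.2 ≤ 0}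

/-- The index set `𝒟_q = {(a,b) : a < (n-1)(q-1), b > 0, a+b < n(q-1)}`. -/
def setD (n : ℕ) (q : ℝ) : Set (ℝ × ℝ) :=
  {p | p.1 < ((n : ℝ) - 1) * (q - 1) ∧ 0 < p.2 ∧ p.1 + p.2 < (n : ℝ) * (q - 1)}

/-- The index set `ℱ = {(a,b) : a + b > -(n-1)}`. -/
def setF (n : ℕ) : Set (ℝ × ℝ) := {p | -((n : ℝ) - 1) < p.1 + p.2}

/-- On a ball of radius `r` centred at the origin of a `d`-dimensional space, the integral of
`‖y‖ ^ p` is at most a constant times `r ^ (d + p)`, provided `p > -d`. -/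
theorem exists_lintegral_ball_norm_rpow_le {E : Type*} [NormedAddCommGroup E] [NormedSpace ℝ E]
    [FiniteDimensional ℝ E] [Nontrivial E] [MeasurableSpace E] [BorelSpace E]
    (μ : Measure E) [μ.IsAddHaarMeasure] {p : ℝ} (hp : -(Module.finrank ℝ E : ℝ) < p) :
    ∃ K : ℝ, 0 < K ∧ ∀ r : ℝ, 0 < r →
      ∫⁻ y in ball (0 : E) r, ENNReal.ofReal (‖y‖ ^ p) ∂μ
        ≤ ENNReal.ofReal (K * r ^ ((Module.finrank ℝ E : ℝ) + p)) := by
  set d := Module.finrank ℝ E with hd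
  have hd0 : 0 < d := Module.finrank_pos
  have hdp : 0 < (d : ℝ) + p := by linarith
  have hμ : 0 < μ.real (ball (0 : E) 1) :=
    ENNReal.toReal_pos (measure_ball_pos μ 0 one_pos).ne' measure_ball_lt_top.ne
  refine ⟨d * (μ.real (ball 0 1) * ((d : ℝ) + p)⁻¹), by positivity, fun r hr => ?_⟩
  have hpow : ∀ y : ℝ, 0 < y → y ^ (d - 1) * y ^ p = y ^ ((d : ℝ) + p - 1) := by
    intro y hy
    rw [← Real.rpow_natCast, ← Real.rpow_add hy, Nat.cast_sub hd0]
    congr 1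
    push_cast
    ring
  have hint : IntegrableOn (fun y : E => ‖y‖ ^ p) (ball 0 r) μ := by
    rw [integrableOn_fun_norm_addHaar μ (f := fun y => y ^ p)]
    have h := (intervalIntegral.intervalIntegrable_rpow' (a := 0) (b := r)
      (r := (d : ℝ) + p - 1) (by linarith))
    rw [intervalIntegrable_iff_integrableOn_Ioo_of_le hr.le] at h
    refine h.congr_fun (fun y hy => ?_) measurableSet_Ioo
    simp only [smul_eq_mul]
    exact (hpow y hy.1).symm
  rw [← ofReal_integral_eq_lintegral_ofReal hint
    (Filter.Eventually.of_forall fun y => Real.rpow_nonneg (norm_nonneg y) p)]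
  refine ENNReal.ofReal_le_ofReal (le_of_eq ?_)
  rw [← integral_indicator measurableSet_ball]
  have h1 : (ball (0 : E) r).indicator (fun y : E => ‖y‖ ^ p)
      = fun y => (Iio r).indicator (fun t : ℝ => t ^ p) ‖y‖ := by
    ext y
    simp [indicator]
  rw [h1, integral_fun_norm_addHaar μ ((Iio r).indicator fun t : ℝ => t ^ p)]
  have h2 : ∫ y in Ioi (0 : ℝ), y ^ (d - 1) • (Iio r).indicator (fun t : ℝ => t ^ p) y
      = ((d : ℝ) + p)⁻¹ * r ^ ((d : ℝ) + p) := by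
    have h3 : ∫ y in Ioi (0 : ℝ), y ^ (d - 1) • (Iio r).indicator (fun t : ℝ => t ^ p) y
        = ∫ y in Ioi (0 : ℝ), (Iio r).indicator (fun t : ℝ => t ^ ((d : ℝ) + p - 1)) y := by
      refine setIntegral_congr_fun measurableSet_Ioi fun y hy => ?_
      by_cases hyr : y < r
      · simp [hyr, hpow y hy]
      · simp [hyr]
    rw [h3, setIntegral_indicator measurableSet_Iio, Ioi_inter_Iio, ← integral_Ioc_eq_integral_Ioo,
      ← intervalIntegral.integral_of_le hr.le, integral_rpow (Or.inl (by linarith))]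
    rw [sub_add_cancel, Real.zero_rpow hdp.ne', sub_zero, div_eq_inv_mul]
  rw [h2]
  simp only [nsmul_eq_mul, smul_eq_mul]
  ring

/-- The projection `x ↦ x'` onto the first `m` coordinates of `ℝ^(m+1)`. -/
def initCoords (m : ℕ) (x : En (m + 1)) : En m := WithLp.toLp 2 fun i => x i.castSucc

theorem normPrime_eq_norm_initCoords (m : ℕ) (x : En (m + 1)) :
    normPrime (m + 1) x = ‖initCoords m x‖ := by
  rw [normPrime, EuclideanSpace.norm_eq, Fin.sum_univ_castSucc]
  simp [initCoords]

theorem normPrime_le_norm (m : ℕ) (x : En (m + 1)) : normPrime (m + 1) x ≤ ‖x‖ := by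
  rw [normPrime, EuclideanSpace.norm_eq]
  refine Real.sqrt_le_sqrt (Finset.sum_le_sum fun i _ => ?_)
  split_ifs
  · simp
  · positivity

theorem normPrime_nonneg (n : ℕ) (x : En n) : 0 ≤ normPrime n x := Real.sqrt_nonneg _

theorem measurable_normPrime (n : ℕ) : Measurable (normPrime n) := by
  unfold normPrime
  refine Measurable.sqrt (Finset.measurable_sum _ fun i _ => ?_)
  split_ifs <;> fun_prop

theorem abs_normPrime_sub_le (m : ℕ) (x y : En (m + 1)) :
    |normPrime (m + 1) x - normPrime (m + 1) y| ≤ ‖x - y‖ := by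
  rw [normPrime_eq_norm_initCoords, normPrime_eq_norm_initCoords]
  refine (abs_norm_sub_norm_le _ _).trans ?_
  have h : initCoords m x - initCoords m y = initCoords m (x - y) := by
    ext i
    simp [initCoords]
  rw [h, ← normPrime_eq_norm_initCoords]
  exact normPrime_le_norm m _

/-- Tonelli for the splitting `ℝ^(m+1) = ℝ^m × ℝ`. -/
theorem lintegral_normPrime_mul_last (m : ℕ) {f g : ℝ → ℝ≥0∞} (hf : Measurable f)
    (hg : Measurable g) :
    ∫⁻ x : En (m + 1), f (normPrime (m + 1) x) * g (x (Fin.last m))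
      = (∫⁻ y : En m, f ‖y‖) * ∫⁻ t, g t := by
  have hF : Measurable fun x : En (m + 1) => f (normPrime (m + 1) x) * g (x (Fin.last m)) :=
    (hf.comp (measurable_normPrime _)).mul (hg.comp (by fun_prop))
  have hfn : Measurable fun y : En m => f ‖y‖ := hf.comp measurable_norm
  have hfn' : Measurable fun y : Fin m → ℝ => f ‖(WithLp.toLp 2 y : En m)‖ :=
    hfn.comp (PiLp.volume_preserving_toLp (Fin m)).measurable
  rw [← (PiLp.volume_preserving_toLp (Fin (m + 1))).lintegral_comp hF,
    ← (PiLp.volume_preserving_toLp (Fin m)).lintegral_comp hfn, mul_comm,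
    ← lintegral_prod_mul hg.aemeasurable hfn'.aemeasurable]
  have h := (volume_preserving_piFinSuccAbove (fun _ : Fin (m + 1) => ℝ)
    (Fin.last m)).lintegral_comp (f := fun z : ℝ × (Fin m → ℝ) =>
      g z.1 * f ‖(WithLp.toLp 2 z.2 : En m)‖)
    ((hg.comp measurable_fst).mul (hfn'.comp measurable_snd))
  refine Eq.trans ?_ h
  refine lintegral_congr fun x => ?_
  rw [normPrime_eq_norm_initCoords, mul_comm]
  simp [initCoords, MeasurableEquiv.piFinSuccAbove, Fin.init_def, Fin.insertNthEquiv]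

theorem ae_coord_ne_zero (n : ℕ) (i : Fin n) : ∀ᵐ x : En n, x i ≠ 0 := by
  have h : ∀ᵐ y : Fin n → ℝ, y i ≠ 0 := Measure.ae_eval_ne (fun _ => volume) i 0
  exact (PiLp.volume_preserving_ofLp (Fin n)).quasiMeasurePreserving.ae h

theorem ae_normPrime_pos (m : ℕ) (hm : 1 ≤ m) : ∀ᵐ x : En (m + 1), 0 < normPrime (m + 1) x := by
  filter_upwards [ae_coord_ne_zero (m + 1) (Fin.castSucc ⟨0, hm⟩)] with x hx
  rw [normPrime_eq_norm_initCoords, norm_pos_iff]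
  intro h
  exact hx (by simpa [initCoords] using congrArg (fun y : En m => y ⟨0, hm⟩) h)

/-- Powers of comparable positive numbers are comparable. -/
theorem rpow_le_three_rpow_abs_mul {t X b : ℝ} (hX : 0 < X) (h1 : X / 3 ≤ t) (h2 : t ≤ 3 * X) :
    t ^ b ≤ 3 ^ |b| * X ^ b := by
  rcases le_total 0 b with hb | hb
  · rw [abs_of_nonneg hb, ← Real.mul_rpow (by norm_num) hX.le]
    exact Real.rpow_le_rpow (by linarith) h2 hb
  · rw [abs_of_nonpos hb, Real.rpow_neg (by norm_num), ← Real.inv_rpow (by norm_num),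
      ← Real.mul_rpow (by norm_num) hX.le]
    exact Real.rpow_le_rpow_of_nonpos (by positivity) (by linarith) hb

/-- A quantity between `c - R` and `c + R` has `b`-th power at most a constant times
`(c + R) ^ b`, if either `b ≥ 0` or `R` is small compared with `c`. -/
theorem rpow_le_of_abs_sub_le {t c R b : ℝ} (ht : 0 ≤ t) (hc : 0 ≤ c) (hR : 0 < R)
    (h : |t - c| ≤ R) (hb : 0 ≤ b ∨ R < c / 2) : t ^ b ≤ 3 ^ |b| * (c + R) ^ b := by
  obtain ⟨h1, h2⟩ := abs_le.1 h
  rcases hb with hb | hb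
  · refine (Real.rpow_le_rpow ht (by linarith : t ≤ c + R) hb).trans ?_
    exact le_mul_of_one_le_left (by positivity) (Real.one_le_rpow (by norm_num) (abs_nonneg b))
  · exact rpow_le_three_rpow_abs_mul (by linarith) (by linarith) (by linarith)

/-- A set contained in the cylinder `{|x'| < r}` has `∫ |x'|^p g(x_n)` controlled by
`r ^ (m + p) ∫ g`. -/
theorem exists_lintegral_cylinder_le (m : ℕ) (hm : 1 ≤ m) {p : ℝ} (hp : -(m : ℝ) < p) :
    ∃ K : ℝ, 0 < K ∧ ∀ (r : ℝ) (g : ℝ → ℝ≥0∞) (s : Set (En (m + 1))), 0 < r → Measurable g →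
      MeasurableSet s → (∀ x ∈ s, normPrime (m + 1) x < r) →
      ∫⁻ x in s, ENNReal.ofReal (normPrime (m + 1) x ^ p) * g (x (Fin.last m))
        ≤ ENNReal.ofReal (K * r ^ ((m : ℝ) + p)) * ∫⁻ t, g t := by
  have : Nonempty (Fin m) := ⟨⟨0, hm⟩⟩
  obtain ⟨K, hK, hball⟩ := exists_lintegral_ball_norm_rpow_le (volume : Measure (En m)) (p := p)
    (by simpa using hp)
  refine ⟨K, hK, fun r g s hr hg hs hsr => ?_⟩
  have hball := hball r hr
  simp only [finrank_euclideanSpace, Fintype.card_fin] at hball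
  let f : ℝ → ℝ≥0∞ := (Iio r).indicator fun t => ENNReal.ofReal (t ^ p)
  have hf : Measurable f :=
    Measurable.indicator (by fun_prop) measurableSet_Iio
  calc ∫⁻ x in s, ENNReal.ofReal (normPrime (m + 1) x ^ p) * g (x (Fin.last m))
      = ∫⁻ x in s, f (normPrime (m + 1) x) * g (x (Fin.last m)) := by
        refine setLIntegral_congr_fun hs fun x hx => ?_
        simp [f, hsr x hx]
    _ ≤ ∫⁻ x, f (normPrime (m + 1) x) * g (x (Fin.last m)) := setLIntegral_le_lintegral _ _
    _ = (∫⁻ y : En m, f ‖y‖) * ∫⁻ t, g t := lintegral_normPrime_mul_last m hf hg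
    _ ≤ _ := by
        gcongr
        refine le_trans (le_of_eq ?_) hball
        rw [← lintegral_indicator measurableSet_ball]
        refine lintegral_congr fun y => ?_
        simp [f, indicator]

theorem volume_ball_eq (m : ℕ) (x : En (m + 1)) {R : ℝ} (hR : 0 < R) :
    volume (ball x R)
      = ENNReal.ofReal (volume.real (ball (0 : En (m + 1)) 1) * R ^ ((m : ℝ) + 1)) := by
  rw [Measure.addHaar_ball_of_pos volume x hR, finrank_euclideanSpace, Fintype.card_fin,
    ENNReal.ofReal_mul measureReal_nonneg, ofReal_measureReal measure_ball_lt_top.ne, mul_comm,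
    ← Real.rpow_natCast]
  push_cast
  rfl

theorem volume_real_unitBall_pos (m : ℕ) : 0 < volume.real (ball (0 : En (m + 1)) 1) :=
  ENNReal.toReal_pos (measure_ball_pos volume 0 one_pos).ne' measure_ball_lt_top.ne

/-- Integral over a ball of the power of `|x'|`. -/
theorem exists_lintegral_ball_normPrime_rpow_le (m : ℕ) (hm : 1 ≤ m) {a : ℝ} (ha : -(m : ℝ) < a) :
    ∃ C : ℝ, 0 < C ∧ ∀ (c : En (m + 1)) (R : ℝ), 0 < R →
      ∫⁻ x in ball c R, ENNReal.ofReal (normPrime (m + 1) x ^ a)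
        ≤ ENNReal.ofReal (C * (normPrime (m + 1) c + R) ^ a * R ^ ((m : ℝ) + 1)) := by
  obtain ⟨K, hK, hcyl⟩ := exists_lintegral_cylinder_le m hm ha
  have hv := volume_real_unitBall_pos m
  set v := volume.real (ball (0 : En (m + 1)) 1) with hv_def
  refine ⟨3 ^ |a| * v + K * 4 ^ ((m : ℝ) + a) * 2 * 3 ^ |a|, by positivity, fun c R hR => ?_⟩
  have hc := normPrime_nonneg (m + 1) c
  have hclose : ∀ x ∈ ball c R, |normPrime (m + 1) x - normPrime (m + 1) c| ≤ R := fun x hx =>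
    (abs_normPrime_sub_le m x c).trans (mem_ball_iff_norm.1 hx).le
  set X := normPrime (m + 1) c + R with hX
  have hX0 : 0 < X := by positivity
  by_cases hcase : 0 ≤ a ∨ R < normPrime (m + 1) c / 2
  · calc ∫⁻ x in ball c R, ENNReal.ofReal (normPrime (m + 1) x ^ a)
        ≤ ∫⁻ x in ball c R, ENNReal.ofReal (3 ^ |a| * X ^ a) := by
          refine setLIntegral_mono measurable_const fun x hx => ENNReal.ofReal_le_ofReal ?_
          exact rpow_le_of_abs_sub_le (normPrime_nonneg _ _) hc hR (hclose x hx) hcase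
      _ = ENNReal.ofReal (3 ^ |a| * v * X ^ a * R ^ ((m : ℝ) + 1)) := by
          rw [setLIntegral_const, volume_ball_eq m c hR, ← ENNReal.ofReal_mul (by positivity)]
          congr 1
          ring
      _ ≤ _ := by
          gcongr
          have : 0 < K * 4 ^ ((m : ℝ) + a) * 2 * 3 ^ |a| := by positivity
          linarith
  · push Not at hcase
    obtain ⟨-, hRc⟩ := hcase
    have hRa : R ^ a ≤ 3 ^ |a| * X ^ a :=
      rpow_le_three_rpow_abs_mul hX0 (by linarith) (by linarith)
    let g : ℝ → ℝ≥0∞ := (Ioo (c (Fin.last m) - R) (c (Fin.last m) + R)).indicator 1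
    have hg : Measurable g := measurable_one.indicator measurableSet_Ioo
    have hgint : ∫⁻ t, g t = ENNReal.ofReal (2 * R) := by
      rw [lintegral_indicator_one measurableSet_Ioo, Real.volume_Ioo]
      congr 1
      ring
    calc ∫⁻ x in ball c R, ENNReal.ofReal (normPrime (m + 1) x ^ a)
        = ∫⁻ x in ball c R, ENNReal.ofReal (normPrime (m + 1) x ^ a) * g (x (Fin.last m)) := by
          refine setLIntegral_congr_fun measurableSet_ball fun x hx => ?_
          have h := (PiLp.norm_apply_le (x - c) (Fin.last m)).trans_lt (mem_ball_iff_norm.1 hx)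
          rw [PiLp.sub_apply, Real.norm_eq_abs, abs_lt] at h
          have hmem : x (Fin.last m) ∈ Ioo (c (Fin.last m) - R) (c (Fin.last m) + R) :=
            ⟨by linarith [h.1], by linarith [h.2]⟩
          simp only [g, indicator_of_mem hmem, Pi.one_apply, mul_one]
      _ ≤ ENNReal.ofReal (K * (4 * R) ^ ((m : ℝ) + a)) * ∫⁻ t, g t := by
          refine hcyl (4 * R) g _ (by positivity) hg measurableSet_ball fun x hx => ?_
          have := (abs_le.1 (hclose x hx)).2
          linarith
      _ ≤ _ := by
          rw [hgint, ← ENNReal.ofReal_mul (by positivity)]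
          refine ENNReal.ofReal_le_ofReal ?_
          have hsplit : K * (4 * R) ^ ((m : ℝ) + a) * (2 * R)
              = K * 4 ^ ((m : ℝ) + a) * 2 * R ^ a * R ^ ((m : ℝ) + 1) := by
            rw [Real.mul_rpow (by norm_num) hR.le, Real.rpow_add hR, Real.rpow_add hR,
              Real.rpow_one]
            ring
          have hnn : 0 ≤ 3 ^ |a| * v * X ^ a * R ^ ((m : ℝ) + 1) := by positivity
          have hmain : K * 4 ^ ((m : ℝ) + a) * 2 * R ^ a * R ^ ((m : ℝ) + 1)
              ≤ K * 4 ^ ((m : ℝ) + a) * 2 * (3 ^ |a| * X ^ a) * R ^ ((m : ℝ) + 1) := by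
            gcongr
          rw [hsplit]
          linarith

/-- For `b < 0`, the factor `|x| ^ b` is dominated by a product of powers of `|x'|` and `|x_n|`. -/
theorem weight_le_of_neg (m : ℕ) {a b e : ℝ} (hbe : b ≤ e) (he : e ≤ 0) {x : En (m + 1)}
    (hx' : 0 < normPrime (m + 1) x) (hx : x (Fin.last m) ≠ 0) :
    weight (m + 1) a b x
      ≤ normPrime (m + 1) x ^ (a + (b - e)) * ‖x (Fin.last m)‖ ^ e := by
  have hn := normPrime_le_norm m x
  have hlast : 0 < ‖x (Fin.last m)‖ := norm_pos_iff.2 hx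
  have hpos : 0 < ‖x‖ := hx'.trans_le hn
  have hb : b = (b - e) + e := by ring
  rw [weight, Real.rpow_add hx', mul_assoc]
  gcongr
  conv_lhs => rw [hb, Real.rpow_add hpos]
  gcongr ?_ * ?_
  · exact Real.rpow_le_rpow_of_nonpos hx' hn (by linarith)
  · exact Real.rpow_le_rpow_of_nonpos hlast (PiLp.norm_apply_le x _) he

/-- Integral of the weight over a ball which is large compared with the norm of its centre, for
`b < 0`. -/
theorem exists_lintegral_large_ball_weight_le (m : ℕ) (hm : 1 ≤ m) {a b : ℝ} (ha : -(m : ℝ) < a)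
    (hab : -((m : ℝ) + 1) < a + b) (hb : b < 0) :
    ∃ C : ℝ, 0 < C ∧ ∀ (c : En (m + 1)) (R : ℝ), 0 < R → ‖c‖ ≤ 2 * R →
      ∫⁻ x in ball c R, ENNReal.ofReal (weight (m + 1) a b x)
        ≤ ENNReal.ofReal (C * (R ^ a * R ^ b) * R ^ ((m : ℝ) + 1)) := by
  obtain ⟨e, he1, he2⟩ : ∃ e, max (-1) b < e ∧ e < min 0 (a + b + m) :=
    exists_between (max_lt (lt_min (by norm_num) (by linarith)) (lt_min hb (by linarith)))
  obtain ⟨he1, hbe⟩ := max_lt_iff.1 he1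
  obtain ⟨he0, he2⟩ := lt_min_iff.1 he2
  obtain ⟨K, hK, hcyl⟩ := exists_lintegral_cylinder_le m hm (p := a + (b - e)) (by linarith)
  obtain ⟨L, hL, hline⟩ := exists_lintegral_ball_norm_rpow_le (volume : Measure ℝ) (p := e)
    (by simpa using he1)
  refine ⟨K * L * 3 ^ ((m : ℝ) + (a + (b - e))) * 3 ^ (1 + e), by positivity,
    fun c R hR hcR => ?_⟩
  have hline := hline (3 * R) (by positivity)
  simp only [Module.finrank_self, Nat.cast_one] at hline
  have hnorm : ∀ x ∈ ball c R, ‖x‖ < 3 * R := fun x hx => by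
    have h1 := mem_ball_iff_norm.1 hx
    have h2 := norm_le_norm_add_norm_sub' x c
    linarith
  let g : ℝ → ℝ≥0∞ := (ball (0 : ℝ) (3 * R)).indicator fun t => ENNReal.ofReal (‖t‖ ^ e)
  have hg : Measurable g := Measurable.indicator (by fun_prop) measurableSet_ball
  calc ∫⁻ x in ball c R, ENNReal.ofReal (weight (m + 1) a b x)
      ≤ ∫⁻ x in ball c R,
          ENNReal.ofReal (normPrime (m + 1) x ^ (a + (b - e))) * g (x (Fin.last m)) := by
        refine lintegral_mono_ae ?_
        filter_upwards [ae_restrict_mem measurableSet_ball,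
          ae_restrict_of_ae (ae_normPrime_pos m hm),
          ae_restrict_of_ae (ae_coord_ne_zero (m + 1) (Fin.last m))] with x hx hx' hxn
        have hmem : x (Fin.last m) ∈ ball (0 : ℝ) (3 * R) :=
          mem_ball_zero_iff.2 ((PiLp.norm_apply_le x _).trans_lt (hnorm x hx))
        simp only [g, indicator_of_mem hmem]
        rw [← ENNReal.ofReal_mul (Real.rpow_nonneg (normPrime_nonneg _ _) _)]
        exact ENNReal.ofReal_le_ofReal (weight_le_of_neg m hbe.le he0.le hx' hxn)
    _ ≤ ENNReal.ofReal (K * (3 * R) ^ ((m : ℝ) + (a + (b - e)))) * ∫⁻ t, g t :=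
        hcyl (3 * R) g _ (by positivity) hg measurableSet_ball fun x hx =>
          (normPrime_le_norm m x).trans_lt (hnorm x hx)
    _ ≤ ENNReal.ofReal (K * (3 * R) ^ ((m : ℝ) + (a + (b - e))))
          * ENNReal.ofReal (L * (3 * R) ^ (1 + e)) := by
        gcongr
        rwa [lintegral_indicator measurableSet_ball]
    _ = _ := by
        rw [← ENNReal.ofReal_mul (by positivity)]
        congr 1
        rw [Real.mul_rpow (by norm_num) hR.le, Real.mul_rpow (by norm_num) hR.le]
        have hpow : R ^ ((m : ℝ) + (a + (b - e))) * R ^ (1 + e)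
            = R ^ a * R ^ b * R ^ ((m : ℝ) + 1) := by
          rw [← Real.rpow_add hR, ← Real.rpow_add hR, ← Real.rpow_add hR]
          congr 1
          ring
        linear_combination
          (K * L * 3 ^ ((m : ℝ) + (a + (b - e))) * 3 ^ (1 + e)) * hpow

/-- The average of the weight over the ball of radius `R` centred at `c` is at most a constant
times `(|c'| + R) ^ a * (|c| + R) ^ b`. -/
theorem exists_average_weight_le (m : ℕ) (hm : 1 ≤ m) {a b : ℝ} (ha : -(m : ℝ) < a)
    (hab : -((m : ℝ) + 1) < a + b) :
    ∃ C : ℝ, 0 < C ∧ ∀ (c : En (m + 1)) (R : ℝ), 0 < R →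
      (volume (ball c R))⁻¹ * ∫⁻ x in ball c R, ENNReal.ofReal (weight (m + 1) a b x)
        ≤ ENNReal.ofReal (C * ((normPrime (m + 1) c + R) ^ a * (‖c‖ + R) ^ b)) := by
  suffices h : ∃ C : ℝ, 0 < C ∧ ∀ (c : En (m + 1)) (R : ℝ), 0 < R →
      ∫⁻ x in ball c R, ENNReal.ofReal (weight (m + 1) a b x)
        ≤ ENNReal.ofReal
          (C * ((normPrime (m + 1) c + R) ^ a * (‖c‖ + R) ^ b) * R ^ ((m : ℝ) + 1)) by
    obtain ⟨C, hC, h⟩ := h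
    have hv := volume_real_unitBall_pos m
    refine ⟨C / volume.real (ball (0 : En (m + 1)) 1), by positivity, fun c R hR => ?_⟩
    rw [← ENNReal.div_eq_inv_mul]
    refine ENNReal.div_le_of_le_mul ((h c R hR).trans (le_of_eq ?_))
    have hc := normPrime_nonneg (m + 1) c
    rw [volume_ball_eq m c hR, ← ENNReal.ofReal_mul (by positivity)]
    congr 1
    field_simp
  obtain ⟨C₁, hC₁, hprime⟩ := exists_lintegral_ball_normPrime_rpow_le m hm ha
  have hsmall : ∀ (c : En (m + 1)) (R : ℝ), 0 < R → (0 ≤ b ∨ R < ‖c‖ / 2) →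
      ∫⁻ x in ball c R, ENNReal.ofReal (weight (m + 1) a b x)
        ≤ ENNReal.ofReal (3 ^ |b| * C₁ * ((normPrime (m + 1) c + R) ^ a * (‖c‖ + R) ^ b)
          * R ^ ((m : ℝ) + 1)) := by
    intro c R hR hcase
    have hc := normPrime_nonneg (m + 1) c
    calc ∫⁻ x in ball c R, ENNReal.ofReal (weight (m + 1) a b x)
        ≤ ∫⁻ x in ball c R, ENNReal.ofReal (3 ^ |b| * (‖c‖ + R) ^ b)
            * ENNReal.ofReal (normPrime (m + 1) x ^ a) := by
          refine setLIntegral_mono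
            (((measurable_normPrime _).pow_const a).ennreal_ofReal.const_mul _) fun x hx => ?_
          rw [← ENNReal.ofReal_mul (by positivity), weight, mul_comm]
          refine ENNReal.ofReal_le_ofReal (mul_le_mul_of_nonneg_right ?_
            (Real.rpow_nonneg (normPrime_nonneg _ _) _))
          exact rpow_le_of_abs_sub_le (norm_nonneg _) (norm_nonneg _) hR
            ((abs_norm_sub_norm_le x c).trans (mem_ball_iff_norm.1 hx).le) hcase
      _ = ENNReal.ofReal (3 ^ |b| * (‖c‖ + R) ^ b)
            * ∫⁻ x in ball c R, ENNReal.ofReal (normPrime (m + 1) x ^ a) :=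
          lintegral_const_mul _ ((measurable_normPrime _).pow_const a).ennreal_ofReal
      _ ≤ ENNReal.ofReal (3 ^ |b| * (‖c‖ + R) ^ b)
            * ENNReal.ofReal (C₁ * (normPrime (m + 1) c + R) ^ a * R ^ ((m : ℝ) + 1)) := by
          gcongr
          exact hprime c R hR
      _ = _ := by
          rw [← ENNReal.ofReal_mul (by positivity)]
          congr 1
          ring
  rcases le_or_gt 0 b with hb | hb
  · exact ⟨3 ^ |b| * C₁, by positivity, fun c R hR => hsmall c R hR (Or.inl hb)⟩
  obtain ⟨C₂, hC₂, hlarge⟩ := exists_lintegral_large_ball_weight_le m hm ha hab hb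
  refine ⟨3 ^ |b| * C₁ + C₂ * (3 ^ |a| * 3 ^ |b|), by positivity, fun c R hR => ?_⟩
  have hc := normPrime_nonneg (m + 1) c
  have hc' := normPrime_le_norm m c
  rcases lt_or_ge R (‖c‖ / 2) with hcase | hcase
  · refine (hsmall c R hR (Or.inr hcase)).trans (ENNReal.ofReal_le_ofReal ?_)
    gcongr
    exact le_add_of_nonneg_right (by positivity)
  · refine (hlarge c R hR (by linarith)).trans (ENNReal.ofReal_le_ofReal ?_)
    gcongr ?_ * _
    have h1 : R ^ a ≤ 3 ^ |a| * (normPrime (m + 1) c + R) ^ a :=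
      rpow_le_three_rpow_abs_mul (by linarith) (by linarith) (by linarith)
    have h2 : R ^ b ≤ 3 ^ |b| * (‖c‖ + R) ^ b :=
      rpow_le_three_rpow_abs_mul (by linarith) (by linarith) (by linarith)
    calc C₂ * (R ^ a * R ^ b)
        ≤ C₂ * ((3 ^ |a| * (normPrime (m + 1) c + R) ^ a) * (3 ^ |b| * (‖c‖ + R) ^ b)) := by
          gcongr
      _ = C₂ * (3 ^ |a| * 3 ^ |b|) * ((normPrime (m + 1) c + R) ^ a * (‖c‖ + R) ^ b) := by
          ring
      _ ≤ _ := by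
          gcongr
          exact le_add_of_nonneg_left (by positivity)

theorem weight_rpow (n : ℕ) (a b s : ℝ) (x : En n) :
    weight n a b x ^ s = weight n (a * s) (b * s) x := by
  have h := normPrime_nonneg n x
  rw [weight, weight, Real.mul_rpow (by positivity) (by positivity), ← Real.rpow_mul h,
    ← Real.rpow_mul (norm_nonneg x)]

/-- for `1 < q < ∞` and `(θ1,θ2) ∈ (𝒜 ∪ ℬ) ∩ (𝒞_q ∪ 𝒟_q)`,
the weight `w = |x'|^θ1 |x|^θ2` is an `A_q`-weight. -/
theorem weight_is_Aq_weight (n : ℕ) (hn : 2 ≤ n) (q θ1 θ2 : ℝ) (hq : 1 < q)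
    (hθ : (θ1, θ2) ∈ (setA n ∪ setB n) ∩ (setC n q ∪ setD n q)) :
    ∃ C : ℝ, 0 < C ∧ ∀ (xbar : En n) (R : ℝ), 0 < R →
      ((volume (ball xbar R))⁻¹ *
          ∫⁻ x in ball xbar R, ENNReal.ofReal (weight n θ1 θ2 x)) *
        ((volume (ball xbar R))⁻¹ *
          ∫⁻ x in ball xbar R, ENNReal.ofReal (weight n θ1 θ2 x ^ (-(1 / (q - 1))))) ^ (q - 1)
      ≤ ENNReal.ofReal C := by
  obtain ⟨m, rfl⟩ : ∃ m, n = m + 1 := ⟨n - 1, by omega⟩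
  have hm : 1 ≤ m := by omega
  have hq' : 0 < q - 1 := by linarith
  simp only [setA, setB, setC, setD, mem_inter_iff, mem_union, mem_ofPred_eq, Nat.cast_add,
    Nat.cast_one, add_sub_cancel_right] at hθ
  obtain ⟨hlow, hupp⟩ := hθ
  have hlow₁ : -(m : ℝ) < θ1 := by rcases hlow with h | h <;> exact h.1
  have hlow₂ : -((m : ℝ) + 1) < θ1 + θ2 := by
    rcases hlow with h | h
    · linarith [h.2]
    · exact h.2.2
  have hupp₁ : θ1 < m * (q - 1) := by rcases hupp with h | h <;> exact h.1
  have hupp₂ : θ1 + θ2 < ((m : ℝ) + 1) * (q - 1) := by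
    rcases hupp with h | h
    · nlinarith [h.2]
    · exact h.2.2
  set s : ℝ := -(1 / (q - 1)) with hs
  have hsq : s * (q - 1) = -1 := by
    rw [hs]
    field_simp
  have hdual₁ : -(m : ℝ) < θ1 * s := by
    rw [hs, mul_neg, mul_one_div, neg_lt_neg_iff, div_lt_iff₀ hq']
    exact hupp₁
  have hdual₂ : -((m : ℝ) + 1) < θ1 * s + θ2 * s := by
    rw [← add_mul, hs, mul_neg, mul_one_div, neg_lt_neg_iff, div_lt_iff₀ hq']
    exact hupp₂
  obtain ⟨C₁, hC₁, h₁⟩ := exists_average_weight_le m hm hlow₁ hlow₂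
  obtain ⟨C₂, hC₂, h₂⟩ := exists_average_weight_le m hm hdual₁ hdual₂
  refine ⟨C₁ * C₂ ^ (q - 1), by positivity, fun c R hR => ?_⟩
  simp only [weight_rpow]
  have hc := normPrime_nonneg (m + 1) c
  refine (mul_le_mul' (h₁ c R hR) (ENNReal.rpow_le_rpow (h₂ c R hR) hq'.le)).trans (le_of_eq ?_)
  set X := normPrime (m + 1) c + R
  set Y := ‖c‖ + R
  have hX : 0 < X := by positivity
  have hY : 0 < Y := by positivity
  rw [ENNReal.ofReal_rpow_of_pos (by positivity), ← ENNReal.ofReal_mul (by positivity)]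
  congr 1
  rw [Real.mul_rpow hC₂.le (by positivity), Real.mul_rpow (by positivity) (by positivity),
    ← Real.rpow_mul hX.le, ← Real.rpow_mul hY.le, mul_assoc θ1, mul_assoc θ2, hsq, mul_neg_one,
    mul_neg_one, Real.rpow_neg hX.le, Real.rpow_neg hY.le]
  have hXa : X ^ θ1 ≠ 0 := (Real.rpow_pos_of_pos hX _).ne'
  have hYb : Y ^ θ2 ≠ 0 := (Real.rpow_pos_of_pos hY _).ne'
  field_simp
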